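/- Let (f_p)_{p∈ℕ} be a sequence of entire functions, each satisfying the quasi-periodicity equation f_p(z+m) = e^{2πiαm} e^{ν(z+m/2)m} f_p(z) for all z ∈ ℂ, m ∈ ℤ, each with ∫_S |f_p(z)|² e^{−ν|z|²} dm(z) < ∞, and which is Cauchy for the norm ‖f‖² = ∫_S |f(z)|² e^{−ν|z|²} dm(z), i.e. ‖f_p − f_q‖ → 0 as p, q → ∞. Then there exists an entire function f satisfying the same quasi-periodicity equation with ‖f‖ < ∞ such that ‖f_p − f‖ → 0 and f_p → f uniformly on compact subsets of ℂ. -/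

import Mathlib

open Complex MeasureTheory ENNReal

namespace StripBargmann

/-- The squared weighted `L²` norm on the strip `0 ≤ Re z ≤ 1`. -/
noncomputable def stripEnergy (ν : ℝ) (h : ℂ → ℂ) : ℝ≥0∞ :=
  ∫⁻ z in {z : ℂ | z.re ∈ Set.Icc (0 : ℝ) 1},
    (‖h z‖₊ : ℝ≥0∞) ^ 2 * ENNReal.ofReal (Real.exp (-ν * Complex.normSq z))

/-- The quasi-periodicity equation with parameters `α` and `ν`. -/
def IsQuasiPeriodic (α ν : ℝ) (h : ℂ → ℂ) : Prop :=
  ∀ (z : ℂ) (m : ℤ), h (z + m) =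
    Complex.exp (2 * Real.pi * Complex.I * α * m) * Complex.exp (ν * (z + m / 2) * m) * h z

lemma setLIntegral_ball_eq_polar (r : ℝ) {G : ℂ → ℝ≥0∞} (hG : Measurable G) :
    ∫⁻ z in Metric.ball 0 r, G z = ∫⁻ ρ in Set.Ioi (0 : ℝ), ∫⁻ θ in Set.Ioo (-Real.pi) Real.pi,
      ENNReal.ofReal ρ * (Metric.ball 0 r).indicator G (circleMap 0 ρ θ) := by
  have hm : Measurable ((Metric.ball (0 : ℂ) r).indicator G) := hG.indicator measurableSet_ball
  have hc : Measurable fun p : ℝ × ℝ => circleMap 0 p.1 p.2 := by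
    unfold circleMap; fun_prop
  rw [← lintegral_indicator measurableSet_ball, ← Complex.lintegral_comp_polarCoord_symm,
    polarCoord_target, Measure.volume_eq_prod, ← setLIntegral_prod
      (fun p : ℝ × ℝ => ENNReal.ofReal p.1 * (Metric.ball 0 r).indicator G (circleMap 0 p.1 p.2))]
  · refine lintegral_congr fun p => ?_
    rw [Complex.polarCoord_symm_apply, smul_eq_mul, circleMap, zero_add, Complex.exp_mul_I]
    push_cast
    rfl
  · exact ((by fun_prop : Measurable fun p : ℝ × ℝ => ENNReal.ofReal p.1).mul
      (hm.comp hc)).aemeasurable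

lemma two_pi_mul_enorm_le_lintegral_circle {F : ℂ → ℂ} (hF : Differentiable ℂ F) (ρ : ℝ) :
    ∫⁻ _ in Set.Ioo (-Real.pi) Real.pi, ‖F 0‖ₑ ≤
      ∫⁻ θ in Set.Ioo (-Real.pi) Real.pi, ‖F (circleMap 0 ρ θ)‖ₑ := by
  have h1 : Real.circleAverage F 0 ρ = F 0 := hF.diffContOnCl.circleAverage
  rw [Real.circleAverage_eq_integral_add (-Real.pi), intervalIntegral.integral_comp_add_right
    (fun θ => F (circleMap 0 ρ θ)), inv_smul_eq_iff₀ (by positivity)] at h1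
  have e : 0 + -Real.pi = -Real.pi ∧ 2 * Real.pi + -Real.pi = Real.pi := by constructor <;> ring
  rw [e.1, e.2, intervalIntegral.integral_of_le (by linarith [Real.pi_pos]),
    integral_Ioc_eq_integral_Ioo] at h1
  have h2 := enorm_integral_le_lintegral_enorm (μ := volume.restrict (Set.Ioo (-Real.pi) Real.pi))
    (fun θ => F (circleMap 0 ρ θ))
  rw [h1] at h2
  refine le_trans (le_of_eq ?_) h2
  rw [setLIntegral_const, Real.volume_Ioo, enorm_smul, mul_comm,
    Real.enorm_of_nonneg (by positivity)]
  congr 2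
  ring

/-- The sub-mean value property on discs for the modulus of an entire function. -/
lemma enorm_mul_volume_ball_le {F : ℂ → ℂ} (hF : Differentiable ℂ F) (c : ℂ) (r : ℝ) :
    ‖F c‖ₑ * volume (Metric.ball c r) ≤ ∫⁻ z in Metric.ball c r, ‖F z‖ₑ := by
  wlog hc : c = 0 generalizing c F
  · have h := this (F := fun z => F (z + c)) (hF.comp (differentiable_id.add_const c)) 0 rfl
    have h2 := (measurePreserving_add_right volume c).setLIntegral_comp_preimage_emb
      (MeasurableEquiv.addRight c).measurableEmbedding (fun z => ‖F z‖ₑ) (Metric.ball c r)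
    have e : (fun z => z + c) ⁻¹' Metric.ball c r = Metric.ball 0 r := by
      ext z; simp [dist_eq_norm]
    rw [e] at h2
    rw [← h2, Measure.addHaar_ball_center volume c]
    simpa using h
  subst hc
  rw [← setLIntegral_const, setLIntegral_ball_eq_polar r measurable_const,
    setLIntegral_ball_eq_polar r hF.continuous.measurable.enorm]
  refine setLIntegral_mono' measurableSet_Ioi fun ρ (hρ : 0 < ρ) => ?_
  rw [lintegral_const_mul' _ _ ofReal_ne_top, lintegral_const_mul' _ _ ofReal_ne_top]
  gcongr ENNReal.ofReal ρ * ?_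
  by_cases hr : ρ < r
  · have hmem : ∀ θ, circleMap 0 ρ θ ∈ Metric.ball (0 : ℂ) r := fun θ => by
      simpa [abs_of_pos hρ] using hr
    simpa only [Set.indicator_of_mem (hmem _)] using two_pi_mul_enorm_le_lintegral_circle hF ρ
  · have hmem : ∀ θ, circleMap 0 ρ θ ∉ Metric.ball (0 : ℂ) r := fun θ => by
      simpa [abs_of_pos hρ] using hr
    simp only [Set.indicator_of_notMem (hmem _), le_refl]

/-- The density of the norm is invariant under integer translations. -/
lemma IsQuasiPeriodic.density_add_int {α ν : ℝ} {h : ℂ → ℂ} (hq : IsQuasiPeriodic α ν h)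
    (z : ℂ) (m : ℤ) :
    (‖h (z + m)‖₊ : ℝ≥0∞) ^ 2 * ENNReal.ofReal (Real.exp (-ν * normSq (z + m))) =
      (‖h z‖₊ : ℝ≥0∞) ^ 2 * ENNReal.ofReal (Real.exp (-ν * normSq z)) := by
  have key : ‖h (z + m)‖ ^ 2 * Real.exp (-ν * normSq (z + m)) =
      ‖h z‖ ^ 2 * Real.exp (-ν * normSq z) := by
    have e1 : (2 * Real.pi * Complex.I * α * m : ℂ).re = 0 := by simp
    have e2 : (ν * (z + m / 2) * m : ℂ).re = ν * (z.re + m / 2) * m := by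
      simp
    rw [hq z m, norm_mul, norm_mul, Complex.norm_exp, Complex.norm_exp, e1, e2, Real.exp_zero,
      one_mul, mul_pow, ← Real.exp_nat_mul, mul_comm (Real.exp _), mul_assoc, ← Real.exp_add]
    congr 2
    simp [normSq_apply]
    ring
  have e : ∀ w, (‖h w‖₊ : ℝ≥0∞) ^ 2 * ENNReal.ofReal (Real.exp (-ν * normSq w)) =
      ENNReal.ofReal (‖h w‖ ^ 2 * Real.exp (-ν * normSq w)) := fun w => by
    rw [ENNReal.ofReal_mul (by positivity), ENNReal.ofReal_pow (norm_nonneg _),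
      ofReal_norm, enorm_eq_nnnorm]
  rw [e, e, key]

lemma IsQuasiPeriodic.setLIntegral_translate {α ν : ℝ} {h : ℂ → ℂ} (hq : IsQuasiPeriodic α ν h)
    (m : ℤ) :
    ∫⁻ z in {z : ℂ | z.re - m ∈ Set.Icc (0 : ℝ) 1},
      (‖h z‖₊ : ℝ≥0∞) ^ 2 * ENNReal.ofReal (Real.exp (-ν * normSq z)) = stripEnergy ν h := by
  have h2 := (measurePreserving_add_right volume (m : ℂ)).setLIntegral_comp_preimage_emb
    (MeasurableEquiv.addRight (m : ℂ)).measurableEmbedding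
    (fun z => (‖h z‖₊ : ℝ≥0∞) ^ 2 * ENNReal.ofReal (Real.exp (-ν * normSq z)))
    {z : ℂ | z.re - m ∈ Set.Icc (0 : ℝ) 1}
  rw [← h2]
  simp only [hq.density_add_int]
  have e : (fun z : ℂ => z + m) ⁻¹' {z : ℂ | z.re - m ∈ Set.Icc (0 : ℝ) 1} =
      {z : ℂ | z.re ∈ Set.Icc (0 : ℝ) 1} := by
    ext z; simp
  rw [e, stripEnergy]

lemma setLIntegral_biUnion_finset_le {ι X : Type*} [MeasurableSpace X] {μ : Measure X}
    (s : Finset ι) (t : ι → Set X) (G : X → ℝ≥0∞) :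
    ∫⁻ x in ⋃ i ∈ s, t i, G x ∂μ ≤ ∑ i ∈ s, ∫⁻ x in t i, G x ∂μ := by
  classical
  induction s using Finset.induction_on with
  | empty => simp
  | insert a s ha ih =>
    rw [Finset.set_biUnion_insert, Finset.sum_insert ha]
    exact (lintegral_union_le _ _ _).trans (by gcongr)

/-- Point evaluations are bounded by the norm, uniformly on discs. -/
lemma exists_enorm_sq_le_mul_stripEnergy (α : ℝ) {ν : ℝ} (hν : 0 < ν) (R : ℝ) :
    ∃ C : ℝ≥0∞, C ≠ ⊤ ∧ ∀ h : ℂ → ℂ, Differentiable ℂ h → IsQuasiPeriodic α ν h →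
      ∀ z ∈ Metric.closedBall (0 : ℂ) R, ‖h z‖ₑ ^ 2 ≤ C * stripEnergy ν h := by
  obtain ⟨N, hN⟩ := exists_nat_ge (R + 1)
  set V : ℝ≥0∞ := volume (Metric.ball (0 : ℂ) 1) with hV
  have hV0 : V ≠ 0 := (Metric.measure_ball_pos volume _ one_pos).ne'
  have hVt : V ≠ ⊤ := measure_ball_lt_top.ne
  set E : ℝ≥0∞ := ENNReal.ofReal (Real.exp (ν * (R + 1) ^ 2)) with hE
  set s : Finset ℤ := Finset.Icc (-(N : ℤ)) N
  refine ⟨V⁻¹ * (E * s.card), mul_ne_top (inv_ne_top.2 hV0)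
    (mul_ne_top ofReal_ne_top (natCast_ne_top _)), fun h hd hq z hz => ?_⟩
  have hz' : ‖z‖ ≤ R := by simpa using hz
  have hsub : ∀ w ∈ Metric.ball z 1, ‖w‖ < R + 1 := fun w hw => by
    rw [Metric.mem_ball, dist_eq_norm] at hw
    have := norm_add_le (w - z) z
    rw [sub_add_cancel] at this
    linarith
  have hcover : Metric.ball z 1 ⊆ ⋃ m ∈ s, {w : ℂ | w.re - (m : ℤ) ∈ Set.Icc (0 : ℝ) 1} := by
    intro w hw
    have h1 := abs_le.1 ((abs_re_le_norm w).trans ((hsub w hw).le.trans hN))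
    simp only [Set.mem_iUnion]
    refine ⟨⌊w.re⌋, Finset.mem_Icc.2 ⟨Int.le_floor.2 (by push_cast; exact h1.1), ?_⟩,
      sub_nonneg.2 (Int.floor_le _), by linarith [Int.lt_floor_add_one w.re]⟩
    exact_mod_cast (Int.floor_le w.re).trans h1.2
  have hmean := enorm_mul_volume_ball_le (hd.pow 2) z 1
  rw [Measure.addHaar_ball_center volume z, ← hV] at hmean
  simp only [Pi.pow_apply, enorm_pow] at hmean
  have hweight : ∫⁻ w in Metric.ball z 1, ‖h w‖ₑ ^ 2 ≤ ∫⁻ w in Metric.ball z 1,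
      E * ((‖h w‖₊ : ℝ≥0∞) ^ 2 * ENNReal.ofReal (Real.exp (-ν * normSq w))) := by
    refine setLIntegral_mono' measurableSet_ball fun w hw => ?_
    have h1 : 1 ≤ E * ENNReal.ofReal (Real.exp (-ν * normSq w)) := by
      rw [hE, ← ofReal_mul (Real.exp_pos _).le, ← Real.exp_add, one_le_ofReal,
        Real.one_le_exp_iff, normSq_eq_norm_sq]
      have : ‖w‖ ^ 2 ≤ (R + 1) ^ 2 := by gcongr; exact (hsub w hw).le
      nlinarith
    calc ‖h w‖ₑ ^ 2 = ‖h w‖ₑ ^ 2 * 1 := (mul_one _).symm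
      _ ≤ ‖h w‖ₑ ^ 2 * (E * ENNReal.ofReal (Real.exp (-ν * normSq w))) := by gcongr
      _ = _ := by rw [enorm_eq_nnnorm]; ring
  have hsum : ∫⁻ w in Metric.ball z 1,
      (‖h w‖₊ : ℝ≥0∞) ^ 2 * ENNReal.ofReal (Real.exp (-ν * normSq w)) ≤
        s.card * stripEnergy ν h := by
    refine (lintegral_mono_set hcover).trans ((setLIntegral_biUnion_finset_le _ _ _).trans ?_)
    simp only [hq.setLIntegral_translate, Finset.sum_const, nsmul_eq_mul, le_refl]
  rw [lintegral_const_mul' _ _ ofReal_ne_top] at hweight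
  have hfin : ‖h z‖ₑ ^ 2 * V ≤ E * (s.card * stripEnergy ν h) :=
    hmean.trans (hweight.trans (by gcongr))
  calc ‖h z‖ₑ ^ 2 = ‖h z‖ₑ ^ 2 * V * V⁻¹ := by
        rw [mul_assoc, ENNReal.mul_inv_cancel hV0 hVt, mul_one]
    _ ≤ E * (s.card * stripEnergy ν h) * V⁻¹ := by gcongr
    _ = _ := by ring

lemma IsQuasiPeriodic.sub {α ν : ℝ} {h k : ℂ → ℂ} (hh : IsQuasiPeriodic α ν h)
    (hk : IsQuasiPeriodic α ν k) : IsQuasiPeriodic α ν (h - k) := fun z m => by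
  simp only [Pi.sub_apply, hh z m, hk z m, mul_sub]

/-- Cauchy sequences for the norm are uniformly Cauchy on discs. -/
lemma uniformCauchySeqOn_closedBall {α ν : ℝ} (hν : 0 < ν) {f : ℕ → ℂ → ℂ}
    (hent : ∀ p, Differentiable ℂ (f p)) (hqp : ∀ p, IsQuasiPeriodic α ν (f p))
    (hC : Filter.Tendsto (fun pq : ℕ × ℕ => stripEnergy ν (f pq.1 - f pq.2))
      Filter.atTop (nhds 0)) (R : ℝ) :
    UniformCauchySeqOn f Filter.atTop (Metric.closedBall 0 R) := by
  obtain ⟨C, hCt, hb⟩ := exists_enorm_sq_le_mul_stripEnergy α hν R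
  have hlim := ENNReal.Tendsto.const_mul hC (Or.inr hCt)
  rw [mul_zero] at hlim
  intro u hu
  obtain ⟨ε, hε, hεu⟩ := mem_uniformity_edist.1 hu
  rw [Filter.prod_atTop_atTop_eq]
  filter_upwards [hlim.eventually_lt_const (ENNReal.pow_pos hε 2)] with pq hpq z hz
  refine hεu ?_
  rw [edist_eq_enorm_sub]
  exact lt_of_pow_lt_pow_left' 2
    ((hb _ ((hent pq.1).sub (hent pq.2)) ((hqp pq.1).sub (hqp pq.2)) z hz).trans_lt hpq)

/-- Fatou's lemma for the norm along a pointwise convergent sequence. -/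
lemma stripEnergy_le_of_tendsto (ν : ℝ) {h : ℕ → ℂ → ℂ} {g : ℂ → ℂ}
    (hc : ∀ q, Continuous (h q))
    (hlim : ∀ z, Filter.Tendsto (fun q => h q z) Filter.atTop (nhds (g z))) {ε : ℝ≥0∞}
    (hε : ∀ᶠ q in Filter.atTop, stripEnergy ν (h q) ≤ ε) : stripEnergy ν g ≤ ε := by
  have hmeas : ∀ q, Measurable fun z : ℂ =>
      (‖h q z‖₊ : ℝ≥0∞) ^ 2 * ENNReal.ofReal (Real.exp (-ν * normSq z)) := fun q => by
    have := (hc q).measurable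
    have := continuous_normSq.measurable
    fun_prop
  have hpt : ∀ z, Filter.liminf (fun q => (‖h q z‖₊ : ℝ≥0∞) ^ 2 *
      ENNReal.ofReal (Real.exp (-ν * normSq z))) Filter.atTop =
        (‖g z‖₊ : ℝ≥0∞) ^ 2 * ENNReal.ofReal (Real.exp (-ν * normSq z)) := fun z => by
    refine Filter.Tendsto.liminf_eq (ENNReal.Tendsto.mul_const ?_ (Or.inr ofReal_ne_top))
    exact ENNReal.Tendsto.pow (ENNReal.tendsto_coe.2 (hlim z).nnnorm)
  have h1 := lintegral_liminf_le (u := Filter.atTop)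
    (μ := volume.restrict {z : ℂ | z.re ∈ Set.Icc (0 : ℝ) 1}) hmeas
  simp only [hpt] at h1
  exact h1.trans (Filter.liminf_le_of_frequently_le' hε.frequently)

lemma stripEnergy_add_le (ν : ℝ) {h k : ℂ → ℂ} (hh : Continuous h) :
    stripEnergy ν (h + k) ≤ 2 * stripEnergy ν h + 2 * stripEnergy ν k := by
  have hm : Measurable fun z : ℂ =>
      2 * ((‖h z‖₊ : ℝ≥0∞) ^ 2 * ENNReal.ofReal (Real.exp (-ν * normSq z))) := by
    have := hh.measurable
    have := continuous_normSq.measurable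
    fun_prop
  unfold stripEnergy
  rw [← lintegral_const_mul' _ _ ofNat_ne_top, ← lintegral_const_mul' _ _ ofNat_ne_top,
    ← lintegral_add_left hm]
  refine lintegral_mono fun z => ?_
  have h1 : (‖(h + k) z‖₊ : ℝ≥0∞) ^ 2 ≤ 2 * (‖h z‖₊ : ℝ≥0∞) ^ 2 + 2 * (‖k z‖₊ : ℝ≥0∞) ^ 2 := by
    norm_cast
    refine (pow_le_pow_left' (nnnorm_add_le (h z) (k z)) 2).trans ?_
    rw [← NNReal.coe_le_coe]
    push_cast
    nlinarith [sq_nonneg (‖h z‖ - ‖k z‖)]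
  calc _ ≤ (2 * (‖h z‖₊ : ℝ≥0∞) ^ 2 + 2 * (‖k z‖₊ : ℝ≥0∞) ^ 2) *
        ENNReal.ofReal (Real.exp (-ν * normSq z)) := by gcongr
    _ = _ := by ring

/-- Completeness of the space of entire quasi-periodic functions of finite norm. -/
lemma exists_limit {α ν : ℝ} (hν : 0 < ν) {f : ℕ → ℂ → ℂ}
    (hent : ∀ p, Differentiable ℂ (f p)) (hqp : ∀ p, IsQuasiPeriodic α ν (f p))
    (hfin : ∀ p, stripEnergy ν (f p) ≠ ⊤)
    (hC : Filter.Tendsto (fun pq : ℕ × ℕ => stripEnergy ν (f pq.1 - f pq.2))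
      Filter.atTop (nhds 0)) :
    ∃ g : ℂ → ℂ, Differentiable ℂ g ∧ IsQuasiPeriodic α ν g ∧ stripEnergy ν g ≠ ⊤ ∧
      Filter.Tendsto (fun p => stripEnergy ν (f p - g)) Filter.atTop (nhds 0) ∧
      TendstoLocallyUniformly f g Filter.atTop := by
  have hU := uniformCauchySeqOn_closedBall hν hent hqp hC
  have hpt : ∀ z, ∃ w, Filter.Tendsto (fun p => f p z) Filter.atTop (nhds w) := fun z =>
    cauchySeq_tendsto_of_complete ((hU ‖z‖).cauchySeq (by simp))
  choose g hg using hpt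
  have hloc : TendstoLocallyUniformly f g Filter.atTop := by
    rw [tendstoLocallyUniformly_iff_forall_isCompact]
    intro K hK
    obtain ⟨R, hR⟩ := hK.isBounded.subset_closedBall 0
    exact ((hU R).tendstoUniformlyOn_of_tendsto fun z _ => hg z).mono hR
  have hgd : Differentiable ℂ g := differentiableOn_univ.1
    ((tendstoLocallyUniformlyOn_univ.2 hloc).differentiableOn
      (Filter.Eventually.of_forall fun p => (hent p).differentiableOn) isOpen_univ)
  have hconv : Filter.Tendsto (fun p => stripEnergy ν (f p - g)) Filter.atTop (nhds 0) := by
    rw [ENNReal.tendsto_nhds_zero]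
    intro ε hε
    obtain ⟨⟨a, b⟩, hab⟩ := Filter.eventually_atTop.1 (ENNReal.tendsto_nhds_zero.1 hC ε hε)
    filter_upwards [Filter.eventually_ge_atTop a] with p hp
    refine stripEnergy_le_of_tendsto ν (h := fun q => f p - f q)
      (fun q => (hent p).continuous.sub (hent q).continuous)
      (fun z => tendsto_const_nhds.sub (hg z)) ?_
    filter_upwards [Filter.eventually_ge_atTop b] with q hq
    exact hab (p, q) ⟨hp, hq⟩
  refine ⟨g, hgd, fun z m => ?_, ?_, hconv, hloc⟩
  · refine tendsto_nhds_unique (hg (z + m)) ?_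
    simp only [hqp _ z m]
    exact (hg z).const_mul _
  · obtain ⟨p, hp⟩ := (hconv.eventually_lt_const one_pos).exists
    have hneg : stripEnergy ν (g - f p) = stripEnergy ν (f p - g) := by
      rw [← neg_sub (f p) g]
      simp only [stripEnergy, Pi.neg_apply, nnnorm_neg]
    have h1 := stripEnergy_add_le ν (k := g - f p) (hent p).continuous
    rw [add_sub_cancel, hneg] at h1
    exact ne_top_of_le_ne_top (add_ne_top.2 ⟨mul_ne_top ofNat_ne_top (hfin p),
      mul_ne_top ofNat_ne_top hp.ne_top⟩) h1

end StripBargmann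

/-- A Cauchy sequence (for the weighted `L²` norm on the strip `S`) of entire
quasi-periodic functions converges, in that norm and uniformly on compact subsets of `ℂ`,
to an entire quasi-periodic function with finite norm. -/
theorem stmt_6 (α ν : ℝ) (hν : 0 < ν) (f : ℕ → ℂ → ℂ)
    (hent : ∀ p, Differentiable ℂ (f p))
    (hqp : ∀ p, ∀ (z : ℂ) (m : ℤ), f p (z + m) =
        Complex.exp (2 * Real.pi * Complex.I * α * m) *
          Complex.exp (ν * (z + m / 2) * m) * f p z)
    (hfin : ∀ p, (∫⁻ z in {z : ℂ | z.re ∈ Set.Icc (0 : ℝ) 1},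
        (‖f p z‖₊ : ℝ≥0∞) ^ 2 * ENNReal.ofReal (Real.exp (-ν * Complex.normSq z))) ≠ ⊤)
    (hCauchy : Filter.Tendsto
      (fun pq : ℕ × ℕ => ∫⁻ z in {z : ℂ | z.re ∈ Set.Icc (0 : ℝ) 1},
        (‖f pq.1 z - f pq.2 z‖₊ : ℝ≥0∞) ^ 2 *
          ENNReal.ofReal (Real.exp (-ν * Complex.normSq z)))
      Filter.atTop (nhds 0)) :
    ∃ g : ℂ → ℂ, Differentiable ℂ g ∧
      (∀ (z : ℂ) (m : ℤ), g (z + m) =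
        Complex.exp (2 * Real.pi * Complex.I * α * m) *
          Complex.exp (ν * (z + m / 2) * m) * g z) ∧
      (∫⁻ z in {z : ℂ | z.re ∈ Set.Icc (0 : ℝ) 1},
        (‖g z‖₊ : ℝ≥0∞) ^ 2 * ENNReal.ofReal (Real.exp (-ν * Complex.normSq z))) ≠ ⊤ ∧
      Filter.Tendsto
        (fun p : ℕ => ∫⁻ z in {z : ℂ | z.re ∈ Set.Icc (0 : ℝ) 1},
          (‖f p z - g z‖₊ : ℝ≥0∞) ^ 2 *
            ENNReal.ofReal (Real.exp (-ν * Complex.normSq z)))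
        Filter.atTop (nhds 0) ∧
      TendstoLocallyUniformly f g Filter.atTop := by
  exact StripBargmann.exists_limit hν hent hqp hfin hCauchy
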